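/- Let k > 0, l > 0, a = 4k/l, and let w(ξ,τ) = ∂_ξψ/ψ where ψ is the heat-equation solution with initial data ψ(ξ,0) = cosh^a(ξ/a), i.e. ψ(ξ,τ) = (4πτ)^{-1/2} ∫_ℝ e^{-(ξ-η)²/(4τ)} cosh^a(η/a) dη for τ > 0. Define u(x,t) = -4k w(4kx, 16k²t) and u_∞(x) = -4k tanh(4kx). Fix δ > 0. Then there exist A > 0 and C > 0 such that for all a ≥ A: sup_{x ∈ ℝ} |u(x,t) - u_∞(x)| ≤ C a^{-(3δ+δ²)} t^{-1/2} for all t ≥ T_* := (1+δ)² a log(a)/(32 k²). -/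

import Mathlib

open Real MeasureTheory

/-- Heat-equation solution with initial data `cosh^a(ξ/a)`, given by the heat kernel
for `τ > 0`. -/
noncomputable def ψ (a ξ τ : ℝ) : ℝ :=
  if τ = 0 then Real.cosh (ξ/a) ^ a
  else (4 * Real.pi * τ) ^ (-(1:ℝ)/2) *
    ∫ η : ℝ, Real.exp (-(ξ - η) ^ 2 / (4 * τ)) * Real.cosh (η/a) ^ a

/-- The corresponding Burgers solution `w = ∂_ξψ/ψ` with initial data `tanh(ξ/a)`. -/
noncomputable def w (a ξ τ : ℝ) : ℝ :=
  deriv (fun y => ψ a y τ) ξ / ψ a ξ τ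

theorem integrable_gaussian_mul_exp {τ : ℝ} (hτ : 0 < τ) (c ξ : ℝ) :
    Integrable (fun z : ℝ => exp (-z ^ 2 / (4 * τ)) * exp (c * (ξ + z))) := by
  have h := ((integrable_exp_neg_mul_sq (b := 1 / (4 * τ)) (by positivity)).comp_sub_right
    (2 * c * τ)).mul_const (exp (c * ξ + c ^ 2 * τ))
  refine h.congr (Filter.Eventually.of_forall fun z => ?_)
  simp only [← Real.exp_add]
  congr 1
  field_simp
  ring

theorem integral_gaussian_mul_exp {τ : ℝ} (hτ : 0 < τ) (c ξ : ℝ) :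
    ∫ z : ℝ, exp (-z ^ 2 / (4 * τ)) * exp (c * (ξ + z)) =
      √(π / (1 / (4 * τ))) * exp (c * ξ + c ^ 2 * τ) := by
  rw [← integral_gaussian, ← integral_sub_right_eq_self (fun x => exp (-(1 / (4 * τ)) * x ^ 2)) (2 * c * τ),
    ← integral_mul_const]
  congr 1
  funext z
  simp only [← Real.exp_add]
  congr 1
  field_simp
  ring

/-- The initial datum `cosh^a(η/a)` multiplied by `2^a`. -/
noncomputable def expSumPow (a η : ℝ) : ℝ := (exp (η / a) + exp (-(η / a))) ^ a

/-- The derivative of `expSumPow a`. -/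
noncomputable def expSumPowDeriv (a η : ℝ) : ℝ :=
  (exp (η / a) + exp (-(η / a))) ^ (a - 1) * (exp (η / a) - exp (-(η / a)))

theorem hasDerivAt_expSumPow {a : ℝ} (ha : 0 < a) (η : ℝ) :
    HasDerivAt (expSumPow a) (expSumPowDeriv a η) η := by
  have h1 : HasDerivAt (fun y : ℝ => y / a) (1 / a) η := (hasDerivAt_id η).div_const a
  have h := (h1.exp.add h1.neg.exp).rpow_const (p := a)
    (Or.inl (by simp only [Pi.add_apply]; positivity))
  refine h.congr_deriv ?_
  simp only [expSumPowDeriv, Pi.add_apply, Pi.neg_apply]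
  field_simp
  ring

theorem continuous_expSumPow {a : ℝ} (ha : 0 < a) : Continuous (expSumPow a) :=
  continuous_iff_continuousAt.2 fun η => (hasDerivAt_expSumPow ha η).continuousAt

theorem continuous_expSumPowDeriv (a : ℝ) : Continuous (expSumPowDeriv a) := by
  unfold expSumPowDeriv
  refine Continuous.mul (Continuous.rpow_const (by fun_prop) fun η => Or.inl ?_) (by fun_prop)
  positivity

theorem exp_div_rpow {a : ℝ} (ha : a ≠ 0) (η : ℝ) : exp (η / a) ^ a = exp η := by
  rw [← Real.exp_mul, div_mul_cancel₀ _ ha]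

theorem exp_neg_div_rpow {a : ℝ} (ha : a ≠ 0) (η : ℝ) : exp (-(η / a)) ^ a = exp (-η) := by
  rw [← neg_div, exp_div_rpow ha]

/-- The excess of `expSumPow a` over `2 cosh` dominates the absolute value of its derivative. -/
theorem abs_expSumPowDeriv_sub_le {a : ℝ} (ha : 1 ≤ a) (η : ℝ) :
    |expSumPowDeriv a η - (exp η - exp (-η))| ≤ expSumPow a η - (exp η + exp (-η)) := by
  have ha0 : a ≠ 0 := by positivity
  unfold expSumPowDeriv expSumPow
  rw [← exp_div_rpow ha0 η, ← exp_neg_div_rpow ha0 η]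
  have hX := exp_pos (η / a)
  have hY := exp_pos (-(η / a))
  generalize exp (η / a) = X at *
  generalize exp (-(η / a)) = Y at *
  have hs : (X + Y) ^ a = (X + Y) ^ (a - 1) * (X + Y) := by
    rw [← Real.rpow_add_one (by positivity), sub_add_cancel]
  have hx : X ^ a ≤ (X + Y) ^ (a - 1) * X := by
    rw [← sub_add_cancel a 1, Real.rpow_add_one hX.ne', add_sub_cancel_right]
    gcongr; linarith
  have hy : Y ^ a ≤ (X + Y) ^ (a - 1) * Y := by
    rw [← sub_add_cancel a 1, Real.rpow_add_one hY.ne', add_sub_cancel_right]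
    gcongr; linarith
  rw [hs, abs_le]
  constructor <;> nlinarith

theorem expSumPow_nonneg (a η : ℝ) : 0 ≤ expSumPow a η := by
  unfold expSumPow; positivity

theorem abs_expSumPowDeriv_le (a η : ℝ) : |expSumPowDeriv a η| ≤ expSumPow a η := by
  unfold expSumPowDeriv expSumPow
  have hX := exp_pos (η / a)
  have hY := exp_pos (-(η / a))
  generalize exp (η / a) = X at *
  generalize exp (-(η / a)) = Y at *
  have hs : (X + Y) ^ a = (X + Y) ^ (a - 1) * (X + Y) := by
    rw [← Real.rpow_add_one (by positivity), sub_add_cancel]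
  rw [hs, abs_mul, abs_of_pos (by positivity : 0 < (X + Y) ^ (a - 1))]
  gcongr
  rw [abs_le]
  constructor <;> linarith

theorem expSumPow_le_exp_abs {a : ℝ} (ha : 0 < a) (η : ℝ) :
    expSumPow a η ≤ 2 ^ a * exp |η| := by
  have h1 : exp (η / a) + exp (-(η / a)) ≤ 2 * exp (|η| / a) := by
    have h2 : exp (η / a) ≤ exp (|η| / a) := by gcongr; exact le_abs_self η
    have h3 : exp (-(η / a)) ≤ exp (|η| / a) := by
      rw [← neg_div]; gcongr; exact neg_le_abs η
    linarith
  calc expSumPow a η ≤ (2 * exp (|η| / a)) ^ a := by unfold expSumPow; gcongr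
    _ = 2 ^ a * exp |η| := by
      rw [Real.mul_rpow (by norm_num) (exp_pos _).le, exp_div_rpow ha.ne']

theorem expSumPow_le_pow {a : ℝ} (ha : 0 < a) {m : ℕ} (hm : a ≤ m) (η : ℝ) :
    expSumPow a η ≤ (exp (η / m) + exp (-(η / m))) ^ m := by
  have hm0 : (0 : ℝ) < m := ha.trans_le hm
  have h := Real.rpow_add_le_add_rpow (exp_pos (η / a)).le (exp_pos (-(η / a))).le
    (p := a / m) (by positivity) ((div_le_one hm0).2 hm)
  have e1 : exp (η / a) ^ (a / m) = exp (η / m) := by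
    rw [← Real.exp_mul]; congr 1; field_simp
  have e2 : exp (-(η / a)) ^ (a / m) = exp (-(η / m)) := by
    rw [← Real.exp_mul]; congr 1; field_simp
  rw [e1, e2] at h
  calc expSumPow a η = ((exp (η / a) + exp (-(η / a))) ^ (a / m)) ^ m := by
        rw [← Real.rpow_mul_natCast (by positivity), div_mul_cancel₀ _ hm0.ne']; rfl
    _ ≤ _ := by gcongr

theorem exp_add_exp_neg_pow (n : ℕ) (η : ℝ) :
    (exp (η / (n + 1 : ℕ)) + exp (-(η / (n + 1 : ℕ)))) ^ (n + 1) =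
      exp η + exp (-η) + ∑ i ∈ Finset.range n,
        ((n + 1).choose (i + 1) : ℝ) * exp ((2 * (i + 1) / (n + 1) - 1) * η) := by
  have key : ∀ j ∈ Finset.range (n + 2),
      exp (η / (n + 1 : ℕ)) ^ j * exp (-(η / (n + 1 : ℕ))) ^ (n + 1 - j) *
        ((n + 1).choose j : ℝ) =
      ((n + 1).choose j : ℝ) * exp ((2 * j / (n + 1) - 1) * η) := by
    intro j hj
    have hj' : j ≤ n + 1 := by simpa [Nat.lt_succ_iff] using hj
    rw [← Real.exp_nat_mul, ← Real.exp_nat_mul, ← Real.exp_add, mul_comm]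
    congr 2
    push_cast [Nat.cast_sub hj']
    field_simp
    ring
  rw [add_pow, Finset.sum_congr rfl key, Finset.sum_range_succ, Finset.sum_range_succ']
  have e : ((2 : ℝ) * ((n + 1 : ℕ) : ℝ) / (n + 1) - 1) * η = η := by
    push_cast; field_simp; ring
  rw [e]
  simp
  ring

theorem integrable_gaussian_mul_of_abs_le {τ : ℝ} (hτ : 0 < τ) {h : ℝ → ℝ} (hc : Continuous h)
    {K : ℝ} (hK : ∀ η, |h η| ≤ K * exp |η|) (ξ : ℝ) :
    Integrable (fun z : ℝ => exp (-z ^ 2 / (4 * τ)) * h (ξ + z)) := by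
  refine (((integrable_gaussian_mul_exp hτ 1 ξ).add
    (integrable_gaussian_mul_exp hτ (-1) ξ)).const_mul K).mono'
    (Continuous.aestronglyMeasurable (by fun_prop)) (Filter.Eventually.of_forall fun z => ?_)
  have hK0 : 0 ≤ K := by
    have := (abs_nonneg _).trans (hK 0)
    simpa using this
  rw [Real.norm_eq_abs, abs_mul, abs_of_pos (exp_pos _), Pi.add_apply]
  calc exp (-z ^ 2 / (4 * τ)) * |h (ξ + z)|
      ≤ exp (-z ^ 2 / (4 * τ)) * (K * (exp (1 * (ξ + z)) + exp ((-1) * (ξ + z)))) := by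
        gcongr
        exact (hK _).trans (by gcongr; simpa only [one_mul, neg_mul] using exp_abs_le _)
    _ = _ := by ring

theorem hasDerivAt_integral_gaussian_mul {τ : ℝ} (hτ : 0 < τ) {h h' : ℝ → ℝ}
    (hd : ∀ η, HasDerivAt h (h' η) η) (hc : Continuous h') {K : ℝ}
    (hK : ∀ η, |h η| ≤ K * exp |η|) (hK' : ∀ η, |h' η| ≤ K * exp |η|) (ξ : ℝ) :
    HasDerivAt (fun y => ∫ z : ℝ, exp (-z ^ 2 / (4 * τ)) * h (y + z))
      (∫ z : ℝ, exp (-z ^ 2 / (4 * τ)) * h' (ξ + z)) ξ := by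
  have hcont : Continuous h := continuous_iff_continuousAt.2 fun η => (hd η).continuousAt
  have hK0 : 0 ≤ K := by
    have := (abs_nonneg _).trans (hK 0)
    simpa using this
  refine (hasDerivAt_integral_of_dominated_loc_of_deriv_le
    (F := fun y z => exp (-z ^ 2 / (4 * τ)) * h (y + z))
    (F' := fun y z => exp (-z ^ 2 / (4 * τ)) * h' (y + z))
    (bound := fun z => exp (-z ^ 2 / (4 * τ)) * (K * exp 1 * exp |ξ + z|))
    (Metric.ball_mem_nhds ξ one_pos)
    (Filter.Eventually.of_forall fun y => Continuous.aestronglyMeasurable (by fun_prop))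
    (integrable_gaussian_mul_of_abs_le hτ hcont hK ξ)
    (Continuous.aestronglyMeasurable (by fun_prop))
    (Filter.Eventually.of_forall fun z y hy => ?_)
    (integrable_gaussian_mul_of_abs_le hτ (h := fun η => K * exp 1 * exp |η|) (K := K * exp 1)
      (by fun_prop) (fun η => (abs_of_nonneg (by positivity)).le) ξ)
    (Filter.Eventually.of_forall fun z y _ => ?_)).2
  · rw [Real.norm_eq_abs, abs_mul, abs_of_pos (exp_pos _)]
    gcongr
    refine (hK' _).trans ?_
    rw [mul_assoc, ← Real.exp_add]
    gcongr
    have h1 : |y - ξ| < 1 := by simpa [Real.dist_eq] using hy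
    have h2 := abs_add_le (y - ξ) (ξ + z)
    have h3 : y - ξ + (ξ + z) = y + z := by ring
    rw [h3] at h2
    linarith
  · exact ((hd (y + z)).comp_add_const y z).const_mul _

theorem ψ_eq {a τ : ℝ} (hτ : 0 < τ) (ξ : ℝ) :
    ψ a ξ τ = (4 * π * τ) ^ (-(1 : ℝ) / 2) * (2 ^ a)⁻¹ *
      ∫ z : ℝ, exp (-z ^ 2 / (4 * τ)) * expSumPow a (ξ + z) := by
  rw [ψ, if_neg hτ.ne', mul_assoc ((4 * π * τ) ^ (-(1 : ℝ) / 2)),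
    ← integral_const_mul ((2 : ℝ) ^ a)⁻¹,
    ← integral_add_left_eq_self _ ξ]
  congr 2
  funext z
  have : cosh ((ξ + z) / a) ^ a = (2 ^ a)⁻¹ * expSumPow a (ξ + z) := by
    rw [Real.cosh_eq, Real.div_rpow (by positivity) (by norm_num), expSumPow]
    field_simp
  rw [this]
  ring_nf

theorem abs_expSumPow_le {a : ℝ} (ha : 0 < a) (η : ℝ) :
    |expSumPow a η| ≤ 2 ^ a * exp |η| := by
  rw [abs_of_nonneg (expSumPow_nonneg a η)]
  exact expSumPow_le_exp_abs ha η

theorem w_eq {a τ : ℝ} (ha : 0 < a) (hτ : 0 < τ) (ξ : ℝ) :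
    w a ξ τ = (∫ z : ℝ, exp (-z ^ 2 / (4 * τ)) * expSumPowDeriv a (ξ + z)) /
      ∫ z : ℝ, exp (-z ^ 2 / (4 * τ)) * expSumPow a (ξ + z) := by
  have hd := hasDerivAt_integral_gaussian_mul hτ (hasDerivAt_expSumPow ha)
    (continuous_expSumPowDeriv a) (abs_expSumPow_le ha)
    (fun η => (abs_expSumPowDeriv_le a η).trans (expSumPow_le_exp_abs ha η)) ξ
  have hK : (4 * π * τ) ^ (-(1 : ℝ) / 2) * ((2 : ℝ) ^ a)⁻¹ ≠ 0 := by positivity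
  rw [w, funext fun y => ψ_eq hτ y, ψ_eq hτ, (hd.const_mul _).deriv,
    mul_div_mul_left _ _ hK]

/-- The sum of the relative sizes of the interior exponential modes at time `τ`. -/
noncomputable def modeSum (n : ℕ) (τ : ℝ) : ℝ :=
  ∑ i ∈ Finset.range n, ((n + 1).choose (i + 1) : ℝ) *
    exp (((2 * (i + 1) / (n + 1) - 1) ^ 2 - 1) * τ)

theorem modeSum_nonneg (n : ℕ) (τ : ℝ) : 0 ≤ modeSum n τ :=
  Finset.sum_nonneg fun i _ => by positivity

theorem integral_gaussian_mul_excess_le {a τ : ℝ} (ha : 1 ≤ a) (hτ : 0 < τ) {n : ℕ}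
    (hn : a ≤ n + 1) (ξ : ℝ) :
    ∫ z : ℝ, exp (-z ^ 2 / (4 * τ)) *
        (expSumPow a (ξ + z) - (exp (ξ + z) + exp (-(ξ + z)))) ≤
      √(π / (1 / (4 * τ))) * ((exp ξ + exp (-ξ)) * exp τ) * modeSum n τ := by
  have ha0 : 0 < a := by positivity
  set c : ℕ → ℝ := fun i => 2 * ((i : ℝ) + 1) / (n + 1) - 1 with hc
  have hc1 : ∀ i ∈ Finset.range n, |c i| ≤ 1 := by
    intro i hi
    have hi' : (i : ℝ) + 1 ≤ n := by exact_mod_cast Finset.mem_range.1 hi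
    have h1 : 0 ≤ ((i : ℝ) + 1) / (n + 1) := by positivity
    have h2 : ((i : ℝ) + 1) / (n + 1) ≤ 1 := (div_le_one (by positivity)).2 (by linarith)
    rw [abs_le, hc]
    simp only [mul_div_assoc]
    constructor <;> linarith
  calc ∫ z : ℝ, exp (-z ^ 2 / (4 * τ)) *
        (expSumPow a (ξ + z) - (exp (ξ + z) + exp (-(ξ + z))))
      ≤ ∫ z : ℝ, ∑ i ∈ Finset.range n, ((n + 1).choose (i + 1) : ℝ) *
          (exp (-z ^ 2 / (4 * τ)) * exp (c i * (ξ + z))) := by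
        refine integral_mono_of_nonneg (Filter.Eventually.of_forall fun z => ?_)
          (integrable_finsetSum _ fun i _ =>
            (integrable_gaussian_mul_exp hτ (c i) ξ).const_mul _)
          (Filter.Eventually.of_forall fun z => ?_)
        · exact mul_nonneg (exp_pos _).le
            ((abs_nonneg _).trans (abs_expSumPowDeriv_sub_le ha (ξ + z)))
        · have h := expSumPow_le_pow ha0 (m := n + 1) (by exact_mod_cast hn) (ξ + z)
          rw [exp_add_exp_neg_pow] at h
          have h' : expSumPow a (ξ + z) - (exp (ξ + z) + exp (-(ξ + z))) ≤
              ∑ i ∈ Finset.range n, ((n + 1).choose (i + 1) : ℝ) * exp (c i * (ξ + z)) := by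
            linarith
          refine (mul_le_mul_of_nonneg_left h' (exp_pos (-z ^ 2 / (4 * τ))).le).trans_eq ?_
          rw [Finset.mul_sum]
          exact Finset.sum_congr rfl fun i _ => by ring
    _ = ∑ i ∈ Finset.range n, ((n + 1).choose (i + 1) : ℝ) *
          (√(π / (1 / (4 * τ))) * exp (c i * ξ + c i ^ 2 * τ)) := by
        rw [integral_finsetSum _ fun i _ =>
          (integrable_gaussian_mul_exp hτ (c i) ξ).const_mul _]
        exact Finset.sum_congr rfl fun i _ => by
          rw [integral_const_mul, integral_gaussian_mul_exp hτ]
    _ ≤ ∑ i ∈ Finset.range n, ((n + 1).choose (i + 1) : ℝ) *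
          (√(π / (1 / (4 * τ))) * ((exp ξ + exp (-ξ)) * exp τ * exp ((c i ^ 2 - 1) * τ))) := by
        refine Finset.sum_le_sum fun i hi => ?_
        gcongr
        rw [mul_assoc, ← Real.exp_add, Real.exp_add (c i * ξ)]
        have h1 : τ + (c i ^ 2 - 1) * τ = c i ^ 2 * τ := by ring
        rw [h1]
        gcongr
        have h2 : c i * ξ ≤ |ξ| := (le_abs_self _).trans (by
          rw [abs_mul]; exact mul_le_of_le_one_left (abs_nonneg _) (hc1 i hi))
        calc exp (c i * ξ) ≤ exp |ξ| := by gcongr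
          _ ≤ _ := exp_abs_le ξ
    _ = _ := by
        rw [modeSum, Finset.mul_sum]
        exact Finset.sum_congr rfl fun i _ => by ring

theorem abs_w_sub_tanh_le {a τ : ℝ} (ha : 1 ≤ a) (hτ : 0 < τ) {n : ℕ} (hn : a ≤ n + 1) (ξ : ℝ) :
    |w a ξ τ - tanh ξ| ≤ 2 * modeSum n τ := by
  have ha0 : 0 < a := by positivity
  set Z := √(π / (1 / (4 * τ))) with hZ
  have hZ0 : 0 < Z := by positivity
  set Q := Z * ((exp ξ + exp (-ξ)) * exp τ) with hQ
  have hQ0 : 0 < Q := by positivity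
  have i1 := integrable_gaussian_mul_exp hτ 1 ξ
  have i2 := integrable_gaussian_mul_exp hτ (-1) ξ
  have iP := integrable_gaussian_mul_of_abs_le hτ (continuous_expSumPow ha0)
    (abs_expSumPow_le ha0) ξ
  have iP' := integrable_gaussian_mul_of_abs_le hτ (continuous_expSumPowDeriv a)
    (fun η => (abs_expSumPowDeriv_le a η).trans (expSumPow_le_exp_abs ha0 η)) ξ
  have e1 := integral_gaussian_mul_exp hτ 1 ξ
  have e2 := integral_gaussian_mul_exp hτ (-1) ξ
  have i12 : Integrable fun z : ℝ => exp (-z ^ 2 / (4 * τ)) * exp (1 * (ξ + z)) +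
      exp (-z ^ 2 / (4 * τ)) * exp ((-1) * (ξ + z)) := i1.add i2
  have i12' : Integrable fun z : ℝ => exp (-z ^ 2 / (4 * τ)) * exp (1 * (ξ + z)) -
      exp (-z ^ 2 / (4 * τ)) * exp ((-1) * (ξ + z)) := i1.sub i2
  rw [w_eq ha0 hτ]
  have hE := integral_gaussian_mul_excess_le ha hτ hn ξ
  have hEP : ∫ z : ℝ, exp (-z ^ 2 / (4 * τ)) *
        (expSumPow a (ξ + z) - (exp (ξ + z) + exp (-(ξ + z)))) =
      (∫ z : ℝ, exp (-z ^ 2 / (4 * τ)) * expSumPow a (ξ + z)) - Q := by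
    have : Q = ∫ z : ℝ, (exp (-z ^ 2 / (4 * τ)) * exp (1 * (ξ + z)) +
        exp (-z ^ 2 / (4 * τ)) * exp ((-1) * (ξ + z))) := by
      rw [integral_add i1 i2, e1, e2, ← hZ, hQ]
      simp only [Real.exp_add, one_mul, neg_mul, one_pow, neg_one_sq]
      ring
    rw [this, ← integral_sub iP i12]
    congr 1
    funext z
    simp only [one_mul, neg_mul]
    ring
  have hEP' : ∫ z : ℝ, exp (-z ^ 2 / (4 * τ)) *
        (expSumPowDeriv a (ξ + z) - (exp (ξ + z) - exp (-(ξ + z)))) =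
      (∫ z : ℝ, exp (-z ^ 2 / (4 * τ)) * expSumPowDeriv a (ξ + z)) - tanh ξ * Q := by
    have : tanh ξ * Q = ∫ z : ℝ, (exp (-z ^ 2 / (4 * τ)) * exp (1 * (ξ + z)) -
        exp (-z ^ 2 / (4 * τ)) * exp ((-1) * (ξ + z))) := by
      rw [integral_sub i1 i2, e1, e2, ← hZ, hQ, Real.tanh_eq]
      simp only [Real.exp_add, one_mul, neg_mul, one_pow, neg_one_sq]
      field_simp
    rw [this, ← integral_sub iP' i12']
    congr 1
    funext z
    simp only [one_mul, neg_mul]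
    ring
  have hE' : |∫ z : ℝ, exp (-z ^ 2 / (4 * τ)) *
        (expSumPowDeriv a (ξ + z) - (exp (ξ + z) - exp (-(ξ + z))))| ≤
      ∫ z : ℝ, exp (-z ^ 2 / (4 * τ)) *
        (expSumPow a (ξ + z) - (exp (ξ + z) + exp (-(ξ + z)))) := by
    rw [← Real.norm_eq_abs]
    refine norm_integral_le_of_norm_le ?_ (Filter.Eventually.of_forall fun z => ?_)
    · refine (iP.sub i12).congr (Filter.Eventually.of_forall fun z => ?_)
      simp only [Pi.sub_apply, one_mul, neg_mul]
      ring
    · rw [Real.norm_eq_abs, abs_mul, abs_of_pos (exp_pos _)]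
      gcongr
      exact abs_expSumPowDeriv_sub_le ha (ξ + z)
  rw [hEP, hEP'] at hE'
  rw [hEP] at hE
  generalize (∫ z : ℝ, exp (-z ^ 2 / (4 * τ)) * expSumPowDeriv a (ξ + z)) = P' at *
  generalize (∫ z : ℝ, exp (-z ^ 2 / (4 * τ)) * expSumPow a (ξ + z)) = P at *
  have hPQ : 0 ≤ P - Q := (abs_nonneg _).trans hE'
  have hP : 0 < P := by linarith
  have hT : |tanh ξ| ≤ 1 := (Real.abs_tanh_lt_one ξ).le
  have hnum : |P' - P * tanh ξ| ≤ 2 * (P - Q) := by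
    have h1 : P' - P * tanh ξ = (P' - tanh ξ * Q) - tanh ξ * (P - Q) := by ring
    rw [h1]
    refine (abs_sub _ _).trans ?_
    rw [abs_mul, abs_of_nonneg hPQ]
    nlinarith [mul_le_mul_of_nonneg_right hT hPQ]
  rw [div_sub' hP.ne', abs_div, abs_of_pos hP, div_le_iff₀ hP]
  nlinarith [mul_nonneg (modeSum_nonneg n τ) hPQ]

theorem sqrt_mul_exp_neg_le {T τ β : ℝ} (hT : 0 < T) (hτ : T ≤ τ) (hβ : 1 ≤ 2 * β * T) :
    √τ * exp (-(β * τ)) ≤ √T * exp (-(β * T)) := by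
  have hs : √(τ / T) ≤ exp (β * (τ - T)) := by
    rw [Real.sqrt_le_left (exp_pos _).le, ← Real.exp_nat_mul]
    have h1 := Real.add_one_le_exp (τ / T - 1)
    have h2 : τ / T - 1 ≤ 2 * β * (τ - T) := by
      have h3 : τ / T - 1 = (τ - T) / T := by field_simp
      rw [h3, div_le_iff₀ hT]
      nlinarith
    calc τ / T ≤ exp (τ / T - 1) := by linarith
      _ ≤ exp ((2 : ℕ) * (β * (τ - T))) := by
        gcongr
        push_cast
        linarith
  have e1 : √τ = √T * √(τ / T) := by
    rw [← Real.sqrt_mul hT.le, mul_div_cancel₀ _ hT.ne']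
  have e2 : exp (-(β * T)) = exp (β * (τ - T)) * exp (-(β * τ)) := by
    rw [← Real.exp_add]; congr 1; ring
  rw [e1, e2, mul_assoc]
  gcongr

/-- A mode coefficient with its relative decay factor at exponent scale `s`. -/
noncomputable def modeTerm (m : ℕ) (s : ℝ) (j : ℕ) : ℝ :=
  (m.choose j : ℝ) * exp (-(s * (j * (m - j) / m ^ 2)))

theorem modeSum_eq (n : ℕ) (τ : ℝ) :
    modeSum n τ = ∑ i ∈ Finset.range n, modeTerm (n + 1) (4 * τ) (i + 1) := by
  refine Finset.sum_congr rfl fun i _ => ?_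
  unfold modeTerm
  congr 2
  push_cast
  field_simp
  ring

theorem modeTerm_symm {m j : ℕ} (hj : j ≤ m) (s : ℝ) :
    modeTerm m s (m - j) = modeTerm m s j := by
  unfold modeTerm
  rw [Nat.choose_symm hj, Nat.cast_sub hj]
  congr 3
  ring

theorem sqrt_mul_modeSum_le {n : ℕ} {T τ : ℝ} (hT : 0 < T) (hτ : T ≤ τ)
    (hn : 1 ≤ 8 * T * (n / ((n : ℝ) + 1) ^ 2)) :
    √τ * modeSum n τ ≤ √T * modeSum n T := by
  rw [modeSum_eq, modeSum_eq, Finset.mul_sum, Finset.mul_sum]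
  refine Finset.sum_le_sum fun i hi => ?_
  have hi' : (i : ℝ) + 1 ≤ n := by exact_mod_cast Finset.mem_range.1 hi
  have hi0 : (0 : ℝ) ≤ i := Nat.cast_nonneg i
  set β : ℝ := 4 * (((i + 1 : ℕ) : ℝ) * (((n + 1 : ℕ) : ℝ) - (i + 1 : ℕ)) /
    ((n + 1 : ℕ) : ℝ) ^ 2) with hβ
  have h1 : 4 * (n / ((n : ℝ) + 1) ^ 2) ≤ β := by
    rw [hβ]
    push_cast
    gcongr
    nlinarith
  have h2 := sqrt_mul_exp_neg_le (β := β) hT hτ (by nlinarith)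
  have e : ∀ x : ℝ, modeTerm (n + 1) (4 * x) (i + 1) =
      ((n + 1).choose (i + 1) : ℝ) * exp (-(β * x)) := by
    intro x
    unfold modeTerm
    congr 2
    rw [hβ]
    ring
  rw [e, e, mul_left_comm, mul_left_comm (√T)]
  gcongr

theorem one_sub_two_div_le {n : ℕ} {a : ℝ} (ha : 1 ≤ a) (hn : (n : ℝ) < a) (hn1 : a ≤ n + 1) :
    1 - 2 / a ≤ a * (n / ((n : ℝ) + 1) ^ 2) := by
  have ha0 : 0 < a := by positivity
  have h1 : 2 / ((n : ℝ) + 1) ≤ 2 / a := by gcongr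
  have h2 : 1 - 2 / ((n : ℝ) + 1) ≤ n * (n / ((n : ℝ) + 1) ^ 2) := by
    rw [← sub_nonneg]
    have : (n : ℝ) * (n / ((n : ℝ) + 1) ^ 2) - (1 - 2 / ((n : ℝ) + 1)) = 1 / ((n : ℝ) + 1) ^ 2 := by
      field_simp
      ring
    rw [this]
    positivity
  have h3 : (n : ℝ) * (n / ((n : ℝ) + 1) ^ 2) ≤ a * (n / ((n : ℝ) + 1) ^ 2) := by gcongr
  linarith

theorem modeTerm_one_le {n : ℕ} {a p : ℝ} (ha : 1 ≤ a) (hp : 0 ≤ p) (hn : (n : ℝ) < a)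
    (hn' : a ≤ n + 1) :
    modeTerm (n + 1) (2 * p * a * log a) 1 ≤
      2 * exp (log a - 2 * p * log a + 4 * p) := by
  have ha0 : 0 < a := by positivity
  have hΛ : 0 ≤ log a := Real.log_nonneg ha
  have hΛa : log a / a ≤ 1 := (div_le_one ha0).2 (Real.log_le_self ha0.le)
  have hfrac : 1 - 2 / a ≤ a * (n / ((n : ℝ) + 1) ^ 2) := one_sub_two_div_le ha hn hn'
  have hexp : 2 * p * log a - 4 * p ≤ 2 * p * a * log a * (n / ((n : ℝ) + 1) ^ 2) := by
    have h1 := mul_le_mul_of_nonneg_left hfrac (mul_nonneg hp hΛ)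
    have h2 : p * log a * (1 - 2 / a) = p * log a - 2 * p * (log a / a) := by ring
    nlinarith
  have e : modeTerm (n + 1) (2 * p * a * log a) 1 =
      ((n : ℝ) + 1) * exp (-(2 * p * a * log a * (n / ((n : ℝ) + 1) ^ 2))) := by
    unfold modeTerm
    rw [Nat.choose_one_right]
    push_cast
    congr 5
    ring
  have e' : 2 * exp (log a - 2 * p * log a + 4 * p) =
      2 * a * exp (-(2 * p * log a - 4 * p)) := by
    rw [show log a - 2 * p * log a + 4 * p = log a + -(2 * p * log a - 4 * p) by ring,
      Real.exp_add, Real.exp_log ha0]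
    ring
  rw [e, e']
  gcongr
  linarith

theorem modeTerm_le {n j : ℕ} {a δ : ℝ} (hδ : 0 < δ) (ha : 3 / δ + 5 ≤ a)
    (hn : (n : ℝ) < a) (hn' : a ≤ n + 1) (hj : 2 ≤ j) (hjn : 2 * j ≤ n + 1) :
    modeTerm (n + 1) (2 * (1 + δ) ^ 2 * a * log a) j ≤
      exp (2 * log a - 4 * (1 + δ) ^ 2 * log a + (2 + 12 * (1 + δ) ^ 2)) := by
  set p := (1 + δ) ^ 2 with hp
  set Λ := log a with hΛdef
  have h3δ : 0 < 3 / δ := by positivity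
  have ha5 : 5 ≤ a := by linarith
  have ha0 : 0 < a := by linarith
  have hΛ1 : 1 ≤ Λ := by
    rw [hΛdef, Real.le_log_iff_exp_le ha0]
    linarith [Real.exp_one_lt_d9]
  have hΛa : Λ / a ≤ 1 := (div_le_one ha0).2 (Real.log_le_self ha0.le)
  have hp0 : 0 ≤ p := by positivity
  set m : ℝ := (n : ℝ) + 1 with hm
  have hm0 : 0 < m := by positivity
  have hj2 : (2 : ℝ) ≤ j := by exact_mod_cast hj
  have hjm : 2 * (j : ℝ) ≤ m := by rw [hm]; exact_mod_cast hjn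
  have hρ : 1 - 1 / m ≤ a / m := by
    rw [le_div_iff₀ hm0, sub_mul, div_mul_cancel₀ _ hm0.ne']
    linarith
  have hinv : 1 / m ≤ 1 / a := by gcongr
  have hinv0 : 0 < 1 / m := by positivity
  have hm4 : 1 / m ≤ 1 / 4 := by gcongr; linarith
  have hlogm : log m ≤ Λ + 1 / a := by
    calc log m ≤ log (a * (1 + 1 / a)) := by
          gcongr
          rw [mul_add, mul_one_div_cancel ha0.ne']
          linarith
      _ = Λ + log (1 + 1 / a) := Real.log_mul ha0.ne' (by positivity)
      _ ≤ Λ + 1 / a := by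
          have := Real.log_le_sub_one_of_pos (show 0 < 1 + 1 / a by positivity)
          linarith
  have hinva : 1 / a ≤ 1 := by rw [div_le_one ha0]; linarith
  have hchoose : ((n + 1).choose j : ℝ) ≤ exp (j * log m) := by
    rw [Real.exp_nat_mul, Real.exp_log hm0, hm]
    exact_mod_cast Nat.choose_le_pow (n + 1) j
  -- concavity of `j ↦ j * (1 - j / m)` on `[2, m / 2]`
  have hconc : 2 * (1 - 2 * (1 / m)) + (j - 2) * (1 / 2 - 2 * (1 / m)) ≤
      j * (1 - j * (1 / m)) := by
    have h1 : (j : ℝ) * (1 / m) ≤ 1 / 2 := by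
      rw [mul_one_div, div_le_iff₀ hm0]; linarith
    nlinarith [mul_nonneg (sub_nonneg.2 hj2) (sub_nonneg.2 h1)]
  have hend : 1 - 3 * (1 / a) ≤ a / m * (1 - 2 * (1 / m)) := by nlinarith
  have hslope : 1 - 5 * (1 / a) ≤ a / m * (1 - 4 * (1 / m)) := by nlinarith
  have hneg : log m ≤ 2 * p * Λ * (a / m * (1 / 2 - 2 * (1 / m))) := by
    have h1 : 3 * (1 / a) + 5 * δ * (1 / a) ≤ δ := by
      have h2 : (3 / δ + 5) * (δ * (1 / a)) ≤ a * (δ * (1 / a)) := by gcongr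
      have h3 : a * (δ * (1 / a)) = δ := by field_simp
      have h4 : (3 / δ + 5) * (δ * (1 / a)) = 3 * (1 / a) + 5 * δ * (1 / a) := by field_simp
      linarith
    have h5 : 1 + 1 / a ≤ p * (1 - 5 * (1 / a)) := by
      have h6 : 0 ≤ 1 - 5 * (1 / a) := by
        have : 5 * (1 / a) ≤ 1 := by rw [mul_one_div, div_le_one ha0]; exact ha5
        linarith
      have h7 : 1 + 2 * δ ≤ p := by rw [hp]; nlinarith
      nlinarith [mul_le_mul_of_nonneg_right h7 h6]
    calc log m ≤ Λ * (1 + 1 / a) := by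
          have : (0 : ℝ) < 1 / a := by positivity
          nlinarith
      _ ≤ Λ * (p * (a / m * (1 - 4 * (1 / m)))) := by
          gcongr
          exact h5.trans (by gcongr)
      _ = _ := by ring
  have hfinal : j * log m - 2 * p * a * Λ * (j * (m - j) / m ^ 2) ≤
      2 * Λ - 4 * p * Λ + (2 + 12 * p) := by
    have e1 : 2 * p * a * Λ * (j * (m - j) / m ^ 2) =
        2 * p * Λ * (a / m) * (j * (1 - j * (1 / m))) := by
      field_simp
    have h1 := mul_le_mul_of_nonneg_left hconc (show 0 ≤ 2 * p * Λ * (a / m) by positivity)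
    have h2 := mul_le_mul_of_nonneg_left hneg (sub_nonneg.2 hj2)
    have h3 := mul_le_mul_of_nonneg_left hend (show 0 ≤ 4 * p * Λ by positivity)
    have h4 : 4 * p * Λ * (1 - 3 * (1 / a)) = 4 * p * Λ - 12 * p * (Λ / a) := by ring
    have h5 : 12 * p * (Λ / a) ≤ 12 * p * 1 := by gcongr
    rw [e1]
    linarith
  calc modeTerm (n + 1) (2 * p * a * Λ) j
      ≤ exp (j * log m) * exp (-(2 * p * a * Λ * (j * (m - j) / m ^ 2))) := by
        unfold modeTerm
        push_cast
        gcongr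
    _ ≤ _ := by
        rw [← Real.exp_add]
        exact Real.exp_le_exp.2 (by linarith)

theorem modeSum_le {n : ℕ} {a δ : ℝ} (hδ : 0 < δ) (ha : 3 / δ + 5 ≤ a)
    (hn : (n : ℝ) < a) (hn' : a ≤ n + 1) :
    modeSum n ((1 + δ) ^ 2 * a * log a / 2) ≤
      4 * exp (log a - 2 * (1 + δ) ^ 2 * log a + 4 * (1 + δ) ^ 2) +
        a * exp (2 * log a - 4 * (1 + δ) ^ 2 * log a + (2 + 12 * (1 + δ) ^ 2)) := by
  have h3δ : 0 < 3 / δ := by positivity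
  have h1a : 1 ≤ a := by linarith
  have hone := modeTerm_one_le h1a (sq_nonneg (1 + δ)) hn hn'
  set B₁ := exp (log a - 2 * (1 + δ) ^ 2 * log a + 4 * (1 + δ) ^ 2)
  set B₂ := exp (2 * log a - 4 * (1 + δ) ^ 2 * log a + (2 + 12 * (1 + δ) ^ 2)) with hB₂
  have hB₁0 : 0 < B₁ := exp_pos _
  have hB₂0 : 0 < B₂ := exp_pos _
  have hterm : ∀ i ∈ Finset.range n,
      modeTerm (n + 1) (2 * (1 + δ) ^ 2 * a * log a) (i + 1) ≤
        B₂ + ((if i = 0 then 2 * B₁ else 0) + if i = n - 1 then 2 * B₁ else 0) := by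
    intro i hi
    have hi' := Finset.mem_range.1 hi
    have hif : ∀ (P : Prop) [Decidable P], 0 ≤ if P then 2 * B₁ else 0 := by
      intro P _; split_ifs <;> positivity
    rcases Nat.eq_zero_or_pos i with h0 | h0
    · have := hif (i = n - 1)
      rw [if_pos h0, h0] at *
      linarith
    by_cases h1 : i = n - 1
    · have h2 : i + 1 = n + 1 - 1 := by omega
      have := hif (i = 0)
      rw [if_pos h1, h2, modeTerm_symm (by omega)]
      linarith
    rw [if_neg h0.ne', if_neg h1, add_zero, add_zero]
    by_cases h2 : 2 * (i + 1) ≤ n + 1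
    · exact modeTerm_le hδ ha hn hn' (by omega) h2
    · rw [← modeTerm_symm (by omega)]
      exact modeTerm_le hδ ha hn hn' (by omega) (by omega)
  have es : 4 * ((1 + δ) ^ 2 * a * log a / 2) = 2 * (1 + δ) ^ 2 * a * log a := by ring
  rw [modeSum_eq, es]
  refine (Finset.sum_le_sum hterm).trans ?_
  rw [Finset.sum_add_distrib, Finset.sum_add_distrib, Finset.sum_ite_eq', Finset.sum_ite_eq',
    Finset.sum_const, Finset.card_range, nsmul_eq_mul]
  have h1 : (n : ℝ) * B₂ ≤ a * B₂ := by gcongr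
  have h2 : ∀ (P : Prop) [Decidable P], (if P then 2 * B₁ else 0) ≤ 2 * B₁ := by
    intro P _; split_ifs <;> linarith
  linarith [h2 (0 ∈ Finset.range n), h2 (n - 1 ∈ Finset.range n)]

theorem sqrt_mul_abs_w_sub_tanh_le {a δ τ : ℝ} (hδ : 0 < δ) (ha : 3 / δ + 5 ≤ a)
    (hτ : (1 + δ) ^ 2 * a * log a / 2 ≤ τ) (ξ : ℝ) :
    √τ * |w a ξ τ - tanh ξ| ≤
      2 * (1 + δ) * (4 * exp (4 * (1 + δ) ^ 2) + exp (2 + 12 * (1 + δ) ^ 2)) *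
        a ^ (-(3 * δ + δ ^ 2)) := by
  have h3δ : 0 < 3 / δ := by positivity
  have ha5 : 5 ≤ a := by linarith
  have ha0 : 0 < a := by linarith
  have hΛ1 : 1 ≤ log a := by
    rw [Real.le_log_iff_exp_le ha0]
    linarith [Real.exp_one_lt_d9]
  have hΛa : log a ≤ a := Real.log_le_self ha0.le
  obtain ⟨n, hn, hn'⟩ : ∃ n : ℕ, (n : ℝ) < a ∧ a ≤ n + 1 := by
    have h1 : ⌈a⌉₊ ≠ 0 := (Nat.ceil_pos.2 ha0).ne'
    obtain ⟨n, hn⟩ := Nat.exists_eq_succ_of_ne_zero h1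
    refine ⟨n, Nat.lt_ceil.1 (by omega), ?_⟩
    have := Nat.le_ceil a
    rw [hn] at this
    exact_mod_cast this
  set T := (1 + δ) ^ 2 * a * log a / 2 with hT
  have hT0 : 0 < T := by positivity
  have hsqrt : √T ≤ (1 + δ) * a := by
    rw [Real.sqrt_le_left (by positivity), hT, mul_pow]
    have : (1 + δ) ^ 2 * (a * log a) ≤ (1 + δ) ^ 2 * (a * a) := by gcongr
    nlinarith [show 0 ≤ (1 + δ) ^ 2 * (a * log a) by positivity]
  have hrate : 1 ≤ 8 * T * (n / ((n : ℝ) + 1) ^ 2) := by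
    have h1 := one_sub_two_div_le (by linarith) hn hn'
    have h2 : 2 / a ≤ 2 / 5 := by gcongr
    have h3 : 1 ≤ (1 + δ) ^ 2 * log a :=
      one_le_mul_of_one_le_of_one_le (one_le_pow₀ (by linarith)) hΛ1
    have e : 8 * T * (n / ((n : ℝ) + 1) ^ 2) =
        4 * ((1 + δ) ^ 2 * log a) * (a * (n / ((n : ℝ) + 1) ^ 2)) := by rw [hT]; ring
    rw [e]
    nlinarith
  have hpow : ∀ c : ℝ, 2 ≤ c → exp (c * log a - c * (1 + δ) ^ 2 * log a) ≤
      a ^ (-(3 * δ + δ ^ 2)) := by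
    intro c hc
    rw [Real.rpow_def_of_pos ha0]
    gcongr
    have h1 : 0 ≤ (2 * δ + δ ^ 2) * log a := by positivity
    nlinarith [mul_le_mul_of_nonneg_right hc h1, mul_nonneg hδ.le (zero_le_one.trans hΛ1),
      mul_nonneg (sq_nonneg δ) (zero_le_one.trans hΛ1)]
  have hw : |w a ξ τ - tanh ξ| ≤ 2 * modeSum n τ :=
    abs_w_sub_tanh_le (by linarith) (hT0.trans_le hτ) hn' ξ
  have hexp : exp (log a) = a := Real.exp_log ha0
  calc √τ * |w a ξ τ - tanh ξ| ≤ √τ * (2 * modeSum n τ) := by gcongr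
    _ = 2 * (√τ * modeSum n τ) := by ring
    _ ≤ 2 * (√T * modeSum n T) := by
        gcongr 2 * ?_
        exact sqrt_mul_modeSum_le hT0 hτ hrate
    _ ≤ 2 * (((1 + δ) * a) *
          (4 * exp (log a - 2 * (1 + δ) ^ 2 * log a + 4 * (1 + δ) ^ 2) +
          a * exp (2 * log a - 4 * (1 + δ) ^ 2 * log a + (2 + 12 * (1 + δ) ^ 2)))) := by
        gcongr 2 * ?_
        exact mul_le_mul hsqrt (modeSum_le hδ ha hn hn') (modeSum_nonneg n T) (by positivity)
    _ = 2 * (1 + δ) * (4 * exp (4 * (1 + δ) ^ 2) *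
            exp (2 * log a - 2 * (1 + δ) ^ 2 * log a) +
          exp (2 + 12 * (1 + δ) ^ 2) * exp (4 * log a - 4 * (1 + δ) ^ 2 * log a)) := by
        have e1 : a * exp (log a - 2 * (1 + δ) ^ 2 * log a + 4 * (1 + δ) ^ 2) =
            exp (4 * (1 + δ) ^ 2) * exp (2 * log a - 2 * (1 + δ) ^ 2 * log a) := by
          nth_rw 1 [← hexp]
          rw [← Real.exp_add, ← Real.exp_add]
          congr 1
          ring
        have e2 : a * (a * exp (2 * log a - 4 * (1 + δ) ^ 2 * log a +
              (2 + 12 * (1 + δ) ^ 2))) =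
            exp (2 + 12 * (1 + δ) ^ 2) * exp (4 * log a - 4 * (1 + δ) ^ 2 * log a) := by
          nth_rw 1 2 [← hexp]
          rw [← Real.exp_add, ← Real.exp_add, ← Real.exp_add]
          congr 1
          ring
        linear_combination 8 * (1 + δ) * e1 + 2 * (1 + δ) * e2
    _ ≤ 2 * (1 + δ) * (4 * exp (4 * (1 + δ) ^ 2) * a ^ (-(3 * δ + δ ^ 2)) +
          exp (2 + 12 * (1 + δ) ^ 2) * a ^ (-(3 * δ + δ ^ 2))) := by
        gcongr
        · exact hpow 2 le_rfl
        · exact hpow 4 (by norm_num)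
    _ = _ := by ring

/-- Corollary 3: the Burgers solution `u(x,t) = -4k w(4kx,16k²t)` with initial data
`-4k tanh(lx)` (where `a = 4k/l`) is within `C a^{-(3δ+δ²)} t^{-1/2}` of the viscous
shock `u_∞(x) = -4k tanh(4kx)` for all `t ≥ T_* = (1+δ)² a log(a)/(32k²)`. -/
theorem shock_convergence_general_data (δ : ℝ) (hδ : 0 < δ) :
    ∃ A C : ℝ, 0 < A ∧ 0 < C ∧
      ∀ k l : ℝ, 0 < k → 0 < l → A ≤ 4 * k / l →
        ∀ t : ℝ, (1 + δ) ^ 2 * (4 * k / l) * Real.log (4 * k / l) / (32 * k ^ 2) ≤ t →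
          ∀ x : ℝ,
            |(-4) * k * w (4*k/l) (4*k*x) (16*k^2*t) - ((-4) * k * Real.tanh (4*k*x))| ≤
              C * (4 * k / l) ^ (-(3 * δ + δ ^ 2)) * t ^ (-(1:ℝ)/2) := by
  refine ⟨3 / δ + 5,
    2 * (1 + δ) * (4 * exp (4 * (1 + δ) ^ 2) + exp (2 + 12 * (1 + δ) ^ 2)),
    by positivity, by positivity, ?_⟩
  intro k l hk hl ha t ht x
  set a := 4 * k / l
  have h3δ : 0 < 3 / δ := by positivity
  have ha1 : 1 < a := by linarith
  have ht0 : 0 < t := by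
    refine lt_of_lt_of_le ?_ ht
    have := Real.log_pos ha1
    positivity
  have hτ : (1 + δ) ^ 2 * a * log a / 2 ≤ 16 * k ^ 2 * t := by
    rw [div_le_iff₀ (by positivity)] at ht
    linarith
  have h := sqrt_mul_abs_w_sub_tanh_le hδ ha hτ (4 * k * x)
  have hs : √(16 * k ^ 2 * t) = 4 * k * √t := by
    rw [Real.sqrt_mul (by positivity), show 16 * k ^ 2 = (4 * k) ^ 2 by ring,
      Real.sqrt_sq (by positivity)]
  have hst : 0 < √t := Real.sqrt_pos.2 ht0
  have hpow : t ^ (-(1 : ℝ) / 2) = (√t)⁻¹ := by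
    rw [Real.sqrt_eq_rpow, ← Real.rpow_neg ht0.le, neg_div]
  have habs : |(-4) * k * w a (4 * k * x) (16 * k ^ 2 * t) - (-4) * k * tanh (4 * k * x)| =
      4 * k * |w a (4 * k * x) (16 * k ^ 2 * t) - tanh (4 * k * x)| := by
    rw [← mul_sub, abs_mul, neg_mul, abs_neg, abs_of_pos (by positivity)]
  rw [habs, hpow, ← div_eq_mul_inv, le_div_iff₀ hst]
  rw [hs] at h
  linarith
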